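/- arXiv:2504.13530 — 2 statements merged into one kernel-verified Lean document; each statement's English description precedes it below -/
import Mathlib

section
/- For every f ∈ C_c(Γ⋉X) and every integer k ≥ 1, one has L_ℓ^k(f^*) = L_ℓ^k(f). -/
open scoped ENNReal

noncomputable section

variable {Γ X : Type*} [Group Γ] [TopologicalSpace X] [MulAction Γ X]

/-- `f ∈ C_c(Γ ⋉ X)` : each `f g : X → ℂ` is continuous, and `f g ≡ 0` for all but
finitely many `g ∈ Γ`. -/
def IsCc (f : Γ → X → ℂ) : Prop :=
  (∀ g : Γ, Continuous (f g)) ∧ {g : Γ | f g ≠ 0}.Finite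

/-- Convolution: `(f ∗ ξ)(g, x) = Σ_{h ∈ Γ} f (g h⁻¹, h ⋅ x) ξ (h, x)`. -/
def convCc (f ξ : Γ → X → ℂ) : Γ → X → ℂ :=
  fun g x => ∑ᶠ h : Γ, f (g * h⁻¹) (h • x) * ξ h x

/-- Involution: `f^*(g, x) = conj (f (g⁻¹, g ⋅ x))`. -/
def starCc (f : Γ → X → ℂ) : Γ → X → ℂ :=
  fun g x => (starRingEnd ℂ) (f g⁻¹ (g • x))

/-- Pointwise multiplication by the length function: `M_ℓ(f)(g,x) = ℓ(g,x) f(g,x)`. -/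
def mulLen (ℓ : Γ → X → ℝ) (f : Γ → X → ℂ) : Γ → X → ℂ :=
  fun g x => (ℓ g x : ℂ) * f g x

/-- Iterated derivation: `Δ⁰(f)(ξ) = f ∗ ξ` and
`Δ^k(f)(ξ) = M_ℓ(Δ^{k-1}(f)(ξ)) − Δ^{k-1}(f)(M_ℓ(ξ))`. -/
def deltaIter (ℓ : Γ → X → ℝ) (f : Γ → X → ℂ) : ℕ → (Γ → X → ℂ) → Γ → X → ℂ
  | 0, ξ => convCc f ξ
  | k + 1, ξ => mulLen ℓ (deltaIter ℓ f k ξ) - deltaIter ℓ f k (mulLen ℓ ξ)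

/-- Hilbert-module norm: `‖ξ‖ = sup_{x ∈ X} (Σ_{g ∈ Γ} |ξ(g,x)|²)^{1/2}`. -/
def hnorm (ξ : Γ → X → ℂ) : ℝ :=
  ⨆ x : X, Real.sqrt (∑ᶠ g : Γ, ‖ξ g x‖ ^ 2)

/-- The I-norm `‖f‖_I`. -/
def normI (f : Γ → X → ℂ) : ℝ :=
  max (⨆ x : X, ∑ᶠ g : Γ, ‖f g x‖) (⨆ x : X, ∑ᶠ g : Γ, ‖f g⁻¹ (g • x)‖)

/-- The `C(X)`-valued inner product: `⟨⟨ξ, η⟩⟩(x) = Σ_{g ∈ Γ} conj(ξ(g,x)) η(g,x)`. -/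
def innerCc (ξ η : Γ → X → ℂ) (x : X) : ℂ :=
  ∑ᶠ g : Γ, (starRingEnd ℂ) (ξ g x) * η g x

/-- Reduced norm: `‖f‖_red = sup { ‖f ∗ ξ‖ : ξ ∈ C_c, ‖ξ‖ ≤ 1 }`. -/
def redNorm (f : Γ → X → ℂ) : ℝ :=
  sSup {r : ℝ | ∃ ξ : Γ → X → ℂ, IsCc ξ ∧ hnorm ξ ≤ 1 ∧ r = hnorm (convCc f ξ)}

/-- The quasi-seminorm `L_ℓ^k(f) = sup { ‖Δ^k(f)(ξ)‖ : ξ ∈ C_c, ‖ξ‖ ≤ 1 }`. -/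
def lipK (ℓ : Γ → X → ℝ) (k : ℕ) (f : Γ → X → ℂ) : ℝ :=
  sSup {r : ℝ | ∃ ξ : Γ → X → ℂ, IsCc ξ ∧ hnorm ξ ≤ 1 ∧ r = hnorm (deltaIter ℓ f k ξ)}

/-- `‖f‖_{2,p,s,ℓ}`. -/
def norm2s (ℓ : Γ → X → ℝ) (p : ℝ) (f : Γ → X → ℂ) : ℝ :=
  ⨆ x : X, Real.sqrt (∑ᶠ g : Γ, ‖f g x‖ ^ 2 * (1 + ℓ g x) ^ (2 * p))

/-- `‖f‖_{2,p,r,ℓ}`. -/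
def norm2r (ℓ : Γ → X → ℝ) (p : ℝ) (f : Γ → X → ℂ) : ℝ :=
  ⨆ x : X, Real.sqrt (∑ᶠ g : Γ, ‖f g⁻¹ (g • x)‖ ^ 2 * (1 + ℓ g x) ^ (2 * p))

/-- `‖f‖_{2,p,ℓ} = max (‖f‖_{2,p,s,ℓ}, ‖f‖_{2,p,r,ℓ})`. -/
def norm2 (ℓ : Γ → X → ℝ) (p : ℝ) (f : Γ → X → ℂ) : ℝ :=
  max (norm2s ℓ p f) (norm2r ℓ p f)

/-- A length function on the transformation groupoid `Γ ⋉ X`. -/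
def IsLength (ℓ : Γ → X → ℝ) : Prop :=
  (∀ g : Γ, Continuous (ℓ g)) ∧ (∀ (g : Γ) (x : X), 0 ≤ ℓ g x) ∧
    (∀ (g : Γ) (x : X), ℓ g x = 0 ↔ g = 1) ∧
    (∀ (g : Γ) (x : X), ℓ g⁻¹ (g • x) = ℓ g x) ∧
    (∀ (g h : Γ) (x : X), ℓ (g * h) x ≤ ℓ g (h • x) + ℓ h x)

/-- Properness: for every `R ≥ 0`, only finitely many non-identity `g` satisfy
`ℓ(g, x) ≤ R` for some `x`. -/
def IsProperLen (ℓ : Γ → X → ℝ) : Prop :=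
  ∀ R : ℝ, {g : Γ | g ≠ 1 ∧ ∃ x : X, ℓ g x ≤ R}.Finite

set_option linter.unusedSectionVars false

namespace IsCc

theorem sub {ξ η : Γ → X → ℂ} (hξ : IsCc ξ) (hη : IsCc η) : IsCc (ξ - η) := by
  refine ⟨fun g => (hξ.1 g).sub (hη.1 g), (hξ.2.union hη.2).subset fun g hg => ?_⟩
  by_contra h
  simp only [Set.mem_union, Set.mem_ofPred_eq, not_or, not_not] at h
  exact hg (by simp [h.1, h.2])

theorem smul {ξ : Γ → X → ℂ} (hξ : IsCc ξ) (c : ℂ) : IsCc (c • ξ) :=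
  ⟨fun g => (hξ.1 g).const_smul c, hξ.2.subset fun g hg h => hg (by simp [h])⟩

theorem mulLen {ℓ : Γ → X → ℝ} (hℓ : ∀ g, Continuous (ℓ g)) {ξ : Γ → X → ℂ} (hξ : IsCc ξ) :
    IsCc (mulLen ℓ ξ) :=
  ⟨fun g => (Complex.continuous_ofReal.comp (hℓ g)).mul (hξ.1 g),
    hξ.2.subset fun g hg h => hg (by funext x; simp [_root_.mulLen, h])⟩

theorem starCc [ContinuousConstSMul Γ X] {f : Γ → X → ℂ} (hf : IsCc f) : IsCc (starCc f) := by
  refine ⟨fun g => Complex.continuous_conj.comp ((hf.1 g⁻¹).comp (continuous_const_smul g)),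
    (hf.2.image (·⁻¹)).subset fun g hg => ⟨g⁻¹, fun h => hg ?_, inv_inv g⟩⟩
  funext x
  simp [_root_.starCc, h]

theorem finsum_eq_sum {M : Type*} [AddCommMonoid M] {ξ : Γ → X → ℂ} (hξ : IsCc ξ) {F : Γ → M}
    (hF : ∀ g, ξ g = 0 → F g = 0) : ∑ᶠ g, F g = ∑ g ∈ hξ.2.toFinset, F g :=
  finsum_eq_sum_of_support_subset F fun g hg => by
    simpa using fun h => hg (hF g h)

theorem convCc_apply {ξ : Γ → X → ℂ} (hξ : IsCc ξ) (f : Γ → X → ℂ) (g : Γ) (x : X) :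
    convCc f ξ g x = ∑ h ∈ hξ.2.toFinset, f (g * h⁻¹) (h • x) * ξ h x :=
  hξ.finsum_eq_sum fun h hh => by simp [hh]

theorem convCc [ContinuousConstSMul Γ X] {f ξ : Γ → X → ℂ} (hf : IsCc f) (hξ : IsCc ξ) :
    IsCc (convCc f ξ) := by
  refine ⟨fun g => ?_, (hf.2.mul hξ.2).subset fun g hg => ?_⟩
  · rw [funext (hξ.convCc_apply f g)]
    exact continuous_finsetSum _ fun h _ =>
      ((hf.1 _).comp (continuous_const_smul h)).mul (hξ.1 h)
  · by_contra hmem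
    refine hg (funext fun x => ?_)
    rw [hξ.convCc_apply]
    refine Finset.sum_eq_zero fun h hh => ?_
    have : f (g * h⁻¹) = 0 := by
      by_contra hne
      exact hmem ⟨g * h⁻¹, hne, h, by simpa using hh, by simp⟩
    simp [this]

theorem deltaIter [ContinuousConstSMul Γ X] {ℓ : Γ → X → ℝ} (hℓ : ∀ g, Continuous (ℓ g))
    {f : Γ → X → ℂ} (hf : IsCc f) (k : ℕ) {ξ : Γ → X → ℂ} (hξ : IsCc ξ) :
    IsCc (deltaIter ℓ f k ξ) := by
  induction k generalizing ξ with
  | zero => exact hf.convCc hξ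
  | succ k ih => exact ((ih hξ).mulLen hℓ).sub (ih (hξ.mulLen hℓ))

end IsCc

theorem starCc_starCc (f : Γ → X → ℂ) : starCc (starCc f) = f := by
  funext g x
  simp [starCc]

theorem deltaIter_smul (ℓ : Γ → X → ℝ) (f : Γ → X → ℂ) (k : ℕ) (c : ℂ) (ξ : Γ → X → ℂ) :
    deltaIter ℓ f k (c • ξ) = c • deltaIter ℓ f k ξ := by
  have hmul (η : Γ → X → ℂ) : mulLen ℓ (c • η) = c • mulLen ℓ η := by
    funext g x
    simp only [mulLen, Pi.smul_apply, smul_eq_mul]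
    ring
  induction k generalizing ξ with
  | zero =>
    funext g x
    simp only [deltaIter, convCc, Pi.smul_apply]
    rw [smul_finsum]
    exact finsum_congr fun h => by simp only [smul_eq_mul]; ring
  | succ k ih => simp only [deltaIter, hmul, ih, smul_sub]

theorem innerCc_sub_left {ξ ξ' : Γ → X → ℂ} {η : Γ → X → ℂ} (hη : IsCc η) (x : X) :
    innerCc (ξ - ξ') η x = innerCc ξ η x - innerCc ξ' η x := by
  simp only [innerCc]
  rw [hη.finsum_eq_sum, hη.finsum_eq_sum, hη.finsum_eq_sum, ← Finset.sum_sub_distrib]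
  · exact Finset.sum_congr rfl fun g _ => by simp [sub_mul]
  all_goals intro g hg; simp [hg]

theorem innerCc_sub_right {ξ : Γ → X → ℂ} (hξ : IsCc ξ) {η η' : Γ → X → ℂ} (x : X) :
    innerCc ξ (η - η') x = innerCc ξ η x - innerCc ξ η' x := by
  simp only [innerCc]
  rw [hξ.finsum_eq_sum, hξ.finsum_eq_sum, hξ.finsum_eq_sum, ← Finset.sum_sub_distrib]
  · exact Finset.sum_congr rfl fun g _ => by simp [mul_sub]
  all_goals intro g hg; simp [hg]

theorem innerCc_mulLen (ℓ : Γ → X → ℝ) (ξ η : Γ → X → ℂ) (x : X) :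
    innerCc (mulLen ℓ ξ) η x = innerCc ξ (mulLen ℓ η) x :=
  finsum_congr fun g => by
    simp only [mulLen, map_mul, Complex.conj_ofReal]
    ring

theorem innerCc_convCc {f ξ η : Γ → X → ℂ} (hξ : IsCc ξ) (hη : IsCc η) (x : X) :
    innerCc (convCc f ξ) η x = innerCc ξ (convCc (starCc f) η) x := by
  simp only [innerCc]
  rw [hη.finsum_eq_sum fun g hg => by simp [hg], hξ.finsum_eq_sum fun g hg => by simp [hg]]
  simp only [hξ.convCc_apply, hη.convCc_apply, map_sum, Finset.sum_mul, Finset.mul_sum]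
  rw [Finset.sum_comm]
  refine Finset.sum_congr rfl fun h _ => Finset.sum_congr rfl fun g _ => ?_
  simp only [starCc, map_mul, mul_inv_rev, inv_inv, smul_smul, inv_mul_cancel_right]
  ring

/-- Up to the sign `(-1)^k`, the operator `Δ^k(f^*)` is the adjoint of `Δ^k(f)`. -/
theorem innerCc_deltaIter [ContinuousConstSMul Γ X] {ℓ : Γ → X → ℝ} (hℓ : ∀ g, Continuous (ℓ g))
    {f : Γ → X → ℂ} (k : ℕ) {ξ η : Γ → X → ℂ} (hξ : IsCc ξ) (hη : IsCc η) (x : X) :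
    innerCc (deltaIter ℓ f k ξ) η x = (-1) ^ k * innerCc ξ (deltaIter ℓ (starCc f) k η) x := by
  induction k generalizing ξ η with
  | zero => simpa [deltaIter] using innerCc_convCc hξ hη x
  | succ k ih =>
    simp only [deltaIter]
    rw [innerCc_sub_left hη, innerCc_sub_right hξ, innerCc_mulLen, ih hξ (hη.mulLen hℓ),
      ih (hξ.mulLen hℓ) hη, innerCc_mulLen]
    ring

theorem hnorm_nonneg (ξ : Γ → X → ℂ) : 0 ≤ hnorm ξ :=
  Real.iSup_nonneg fun _ => Real.sqrt_nonneg _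

theorem hnorm_smul (c : ℂ) (ξ : Γ → X → ℂ) : hnorm (c • ξ) = ‖c‖ * hnorm ξ := by
  simp only [hnorm]
  rw [Real.mul_iSup_of_nonneg (norm_nonneg c)]
  congr 1
  funext x
  have : ∑ᶠ g, ‖(c • ξ) g x‖ ^ 2 = ‖c‖ ^ 2 * ∑ᶠ g, ‖ξ g x‖ ^ 2 := by
    rw [← smul_eq_mul, smul_finsum]
    exact finsum_congr fun g => by simp [mul_pow]
  rw [this, Real.sqrt_mul (by positivity), Real.sqrt_sq (norm_nonneg c)]

theorem IsCc.sqrt_le_hnorm [CompactSpace X] {ξ : Γ → X → ℂ} (hξ : IsCc ξ) (x : X) :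
    √(∑ᶠ g, ‖ξ g x‖ ^ 2) ≤ hnorm ξ := by
  refine le_ciSup (f := fun x => √(∑ᶠ g, ‖ξ g x‖ ^ 2)) (IsCompact.bddAbove ?_) x
  have hsum (x : X) : ∑ᶠ g, ‖ξ g x‖ ^ 2 = ∑ g ∈ hξ.2.toFinset, ‖ξ g x‖ ^ 2 :=
    hξ.finsum_eq_sum fun g hg => by simp [hg]
  simp only [hsum]
  exact isCompact_range
    (continuous_finsetSum _ fun g _ => (hξ.1 g).norm.pow 2).sqrt

theorem IsCc.norm_innerCc_le [CompactSpace X] {ξ η : Γ → X → ℂ} (hξ : IsCc ξ) (hη : IsCc η)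
    (x : X) : ‖innerCc ξ η x‖ ≤ hnorm ξ * hnorm η := by
  classical
  have hsum {ζ : Γ → X → ℂ} {s : Finset Γ} (hs : ∀ g, ζ g ≠ 0 → g ∈ s) :
      ∑ᶠ g, ‖ζ g x‖ ^ 2 = ∑ g ∈ s, ‖ζ g x‖ ^ 2 :=
    finsum_eq_sum_of_support_subset _ fun g hg => hs g fun h => hg (by simp [h])
  set s := hξ.2.toFinset ∪ hη.2.toFinset with hs
  have hξs := hsum (ζ := ξ) (s := s) fun g hg => by simp [hs, hg]
  have hηs := hsum (ζ := η) (s := s) fun g hg => by simp [hs, hg]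
  have hinner : innerCc ξ η x = ∑ g ∈ s, (starRingEnd ℂ) (ξ g x) * η g x :=
    finsum_eq_sum_of_support_subset _ fun g hg => by
      have : ξ g ≠ 0 := fun h => hg (by simp [h])
      simp [hs, this]
  calc ‖innerCc ξ η x‖ ≤ ∑ g ∈ s, ‖ξ g x‖ * ‖η g x‖ := by
        rw [hinner]
        exact (norm_sum_le _ _).trans_eq (Finset.sum_congr rfl fun g _ => by simp)
    _ ≤ √(∑ g ∈ s, ‖ξ g x‖ ^ 2) * √(∑ g ∈ s, ‖η g x‖ ^ 2) :=
        Real.sum_mul_le_sqrt_mul_sqrt _ _ _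
    _ ≤ hnorm ξ * hnorm η := by
        rw [← hξs, ← hηs]
        exact mul_le_mul (hξ.sqrt_le_hnorm x) (hη.sqrt_le_hnorm x) (Real.sqrt_nonneg _)
          (hnorm_nonneg ξ)

theorem IsCc.finsum_sq_eq_norm_innerCc_self {ξ : Γ → X → ℂ} (hξ : IsCc ξ) (x : X) :
    ∑ᶠ g, ‖ξ g x‖ ^ 2 = ‖innerCc ξ ξ x‖ := by
  have hinner : innerCc ξ ξ x = ((∑ g ∈ hξ.2.toFinset, ‖ξ g x‖ ^ 2 : ℝ) : ℂ) := by
    rw [innerCc, hξ.finsum_eq_sum fun g hg => by simp [hg]]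
    push_cast
    exact Finset.sum_congr rfl fun g _ => Complex.conj_mul' _
  rw [hinner, Complex.norm_real, Real.norm_of_nonneg (by positivity),
    hξ.finsum_eq_sum fun g hg => by simp [hg]]

/-- A bound for `Δ^k(f)` on the unit ball is also a bound for its adjoint. -/
theorem hnorm_deltaIter_starCc_le [CompactSpace X] [ContinuousConstSMul Γ X] {ℓ : Γ → X → ℝ}
    (hℓ : ∀ g, Continuous (ℓ g)) {f : Γ → X → ℂ} (hf : IsCc f) (k : ℕ) {C : ℝ} (hC : 0 ≤ C)
    (h : ∀ ξ : Γ → X → ℂ, IsCc ξ → hnorm ξ ≤ 1 → hnorm (deltaIter ℓ f k ξ) ≤ C)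
    {η : Γ → X → ℂ} (hη : IsCc η) (hη1 : hnorm η ≤ 1) :
    hnorm (deltaIter ℓ (starCc f) k η) ≤ C := by
  set ξ := deltaIter ℓ (starCc f) k η with hξdef
  have hξ : IsCc ξ := hf.starCc.deltaIter hℓ k hη
  have hTξ : IsCc (deltaIter ℓ f k ξ) := hf.deltaIter hℓ k hξ
  rcases (hnorm_nonneg ξ).eq_or_lt with h0 | hpos
  · rwa [← h0]
  have hbound : hnorm (deltaIter ℓ f k ξ) ≤ C * hnorm ξ := by
    have hnorm_inv : ‖((hnorm ξ)⁻¹ : ℂ)‖ = (hnorm ξ)⁻¹ := by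
      rw [← Complex.ofReal_inv, Complex.norm_real, Real.norm_of_nonneg (inv_nonneg.2 hpos.le)]
    have := h (((hnorm ξ)⁻¹ : ℂ) • ξ) (hξ.smul _)
      (by rw [hnorm_smul, hnorm_inv, inv_mul_cancel₀ hpos.ne'])
    rwa [deltaIter_smul, hnorm_smul, hnorm_inv, inv_mul_le_iff₀ hpos, mul_comm] at this
  have hsq (x : X) : √(∑ᶠ g, ‖ξ g x‖ ^ 2) ≤ √(C * hnorm ξ) := by
    refine Real.sqrt_le_sqrt ?_
    have hadj : ‖innerCc ξ ξ x‖ = ‖innerCc (deltaIter ℓ f k ξ) η x‖ := by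
      rw [innerCc_deltaIter hℓ k hξ hη]
      simp [← hξdef]
    rw [hξ.finsum_sq_eq_norm_innerCc_self, hadj]
    calc _ ≤ hnorm (deltaIter ℓ f k ξ) * hnorm η := hTξ.norm_innerCc_le hη x
      _ ≤ hnorm (deltaIter ℓ f k ξ) * 1 := mul_le_mul_of_nonneg_left hη1 (hnorm_nonneg _)
      _ ≤ C * hnorm ξ := by rwa [mul_one]
  have hle : hnorm ξ ≤ √(C * hnorm ξ) := Real.iSup_le hsq (Real.sqrt_nonneg _)
  rw [Real.le_sqrt hpos.le (by positivity), sq] at hle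
  exact le_of_mul_le_mul_right hle hpos

theorem upperBounds_deltaIter_subset_starCc [CompactSpace X] [ContinuousConstSMul Γ X]
    {ℓ : Γ → X → ℝ} (hℓ : ∀ g, Continuous (ℓ g)) {f : Γ → X → ℂ} (hf : IsCc f) (k : ℕ) :
    upperBounds {r : ℝ | ∃ ξ : Γ → X → ℂ,
      IsCc ξ ∧ hnorm ξ ≤ 1 ∧ r = hnorm (deltaIter ℓ f k ξ)} ⊆
    upperBounds {r : ℝ | ∃ ξ : Γ → X → ℂ,
      IsCc ξ ∧ hnorm ξ ≤ 1 ∧ r = hnorm (deltaIter ℓ (starCc f) k ξ)} := by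
  rintro C hC _ ⟨η, hη, hη1, rfl⟩
  have h (ξ : Γ → X → ℂ) (hξ : IsCc ξ) (hξ1 : hnorm ξ ≤ 1) : hnorm (deltaIter ℓ f k ξ) ≤ C :=
    hC ⟨ξ, hξ, hξ1, rfl⟩
  exact hnorm_deltaIter_starCc_le hℓ hf k ((hnorm_nonneg _).trans (h η hη hη1)) h hη hη1

theorem Real.sSup_eq_of_upperBounds_eq {s t : Set ℝ} (h : upperBounds s = upperBounds t)
    (hs : s.Nonempty) (ht : t.Nonempty) : sSup s = sSup t := by
  by_cases hb : BddAbove s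
  · exact (isLUB_csSup hs hb).unique
      (by rw [IsLUB, h]; exact isLUB_csSup ht (by rwa [BddAbove, ← h]))
  · rw [Real.sSup_of_not_bddAbove hb, Real.sSup_of_not_bddAbove (by rwa [BddAbove, ← h])]

/-- `L_ℓ^k(f^*) = L_ℓ^k(f)`. -/
theorem stmt_5 [CompactSpace X] [T2Space X] [ContinuousConstSMul Γ X]
    (ℓ : Γ → X → ℝ) (hℓ : IsLength ℓ)
    (f : Γ → X → ℂ) (hf : IsCc f) (k : ℕ) (hk : 1 ≤ k) :
    lipK ℓ k (starCc f) = lipK ℓ k f := by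
  have hzero : IsCc (0 : Γ → X → ℂ) := ⟨fun _ => continuous_const, by simp⟩
  have hnorm_zero : hnorm (0 : Γ → X → ℂ) ≤ 1 := by simp [hnorm]
  refine Real.sSup_eq_of_upperBounds_eq (Set.Subset.antisymm ?_ ?_)
    ⟨_, 0, hzero, hnorm_zero, rfl⟩ ⟨_, 0, hzero, hnorm_zero, rfl⟩
  · simpa only [starCc_starCc] using upperBounds_deltaIter_subset_starCc hℓ.1 hf.starCc k
  · exact upperBounds_deltaIter_subset_starCc hℓ.1 hf k
end
end

section
/- Let ℓ be a continuous proper length function on Γ⋉X, let p > 0, and let k > p be an integer. Then there exists a real number α > 0 such that for every f ∈ C_c(Γ⋉X) with f(e,x) = 0 for all x ∈ X, one has ‖f‖_{2,p,ℓ} ≤ α · L_ℓ^k(f). -/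
open scoped ENNReal

noncomputable section

variable {Γ X : Type*} [Group Γ] [TopologicalSpace X] [MulAction Γ X]

/-- Closed form of the iterated derivation: its kernel is
`(ℓ(g,x) - ℓ(h,x))^k f(gh⁻¹, h • x)`. -/
theorem deltaIter_apply {Γ X : Type*} [Group Γ] [MulAction Γ X]
    (ℓ : Γ → X → ℝ) (f : Γ → X → ℂ) (k : ℕ) (ξ : Γ → X → ℂ) (x : X)
    (hξ : (Function.support fun h => ξ h x).Finite) (g : Γ) :
    deltaIter ℓ f k ξ g x =
      ∑ᶠ h : Γ, ((ℓ g x - ℓ h x : ℝ) : ℂ) ^ k * f (g * h⁻¹) (h • x) * ξ h x := by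
  induction k generalizing ξ with
  | zero => simp [deltaIter, convCc]
  | succ k ih =>
    have hξ' : (Function.support fun h => mulLen ℓ ξ h x).Finite :=
      hξ.subset fun h hh => right_ne_zero_of_mul hh
    have hs : ∀ c : Γ → ℂ, (Function.support fun h => c h * ξ h x).Finite := fun c =>
      hξ.subset fun h hh => right_ne_zero_of_mul hh
    change (ℓ g x : ℂ) * deltaIter ℓ f k ξ g x - deltaIter ℓ f k (mulLen ℓ ξ) g x = _
    rw [ih ξ hξ, ih _ hξ', mul_finsum' _ _ (hs _), ← finsum_sub_distrib]
    · refine finsum_congr fun h => ?_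
      simp only [mulLen]
      push_cast
      ring
    · exact (hs _).subset fun h hh => right_ne_zero_of_mul hh
    · exact hξ'.subset fun h hh => right_ne_zero_of_mul hh

theorem IsCc.finite_support {Γ X : Type*} [TopologicalSpace X]
    {f : Γ → X → ℂ} (hf : IsCc f) (x : X) :
    (Function.support fun h => f h x).Finite :=
  hf.2.subset fun h hh h0 => hh (by simp [h0])

theorem IsLength.abs_sub_le {ℓ : Γ → X → ℝ} (hℓ : IsLength ℓ) (u h : Γ) (x : X) :
    |ℓ (u * h) x - ℓ h x| ≤ ℓ u (h • x) := by
  obtain ⟨-, -, -, hinv, htri⟩ := hℓ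
  have h1 := htri u h x
  have h2 := htri u⁻¹ (u * h) x
  rw [mul_smul, hinv, inv_mul_cancel_left] at h2
  rw [abs_le]
  constructor <;> linarith

/-- A function dominated by finitely many left translates of `η` is controlled in `ℓ²`. -/
theorem finsum_sq_le_of_le_sum_translates {G : Type*} [Group G] (F : Finset G) (B : ℝ)
    (η D : G → ℝ) (hη : (Function.support η).Finite) (hD0 : ∀ g, 0 ≤ D g)
    (hD : ∀ g, D g ≤ B * ∑ u ∈ F, η (u⁻¹ * g)) :
    ∑ᶠ g, D g ^ 2 ≤ (F.card * B) ^ 2 * ∑ᶠ g, η g ^ 2 := by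
  have hsq : (Function.support fun g => η g ^ 2).Finite :=
    hη.subset fun g hg h0 => hg (by simp [h0])
  have htr : ∀ u : G, (Function.support fun g => η (u⁻¹ * g) ^ 2).Finite := fun u =>
    hsq.preimage (f := fun g => u⁻¹ * g) (mul_right_injective u⁻¹).injOn
  have hle : ∀ g, D g ^ 2 ≤ B ^ 2 * F.card * ∑ u ∈ F, η (u⁻¹ * g) ^ 2 := fun g => by
    calc D g ^ 2 ≤ (B * ∑ u ∈ F, η (u⁻¹ * g)) ^ 2 := pow_le_pow_left₀ (hD0 g) (hD g) 2
      _ = B ^ 2 * (∑ u ∈ F, η (u⁻¹ * g)) ^ 2 := by ring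
      _ ≤ B ^ 2 * (F.card * ∑ u ∈ F, η (u⁻¹ * g) ^ 2) := by
        gcongr
        exact sq_sum_le_card_mul_sum_sq
      _ = _ := by ring
  have hfin : (Function.support fun g => ∑ u ∈ F, η (u⁻¹ * g) ^ 2).Finite := by
    refine (F.finite_toSet.biUnion fun u _ => htr u).subset fun g hg => ?_
    obtain ⟨u, hu, hne⟩ := Finset.exists_ne_zero_of_sum_ne_zero hg
    exact Set.mem_biUnion hu hne
  have hfin' : (Function.support fun g =>
      B ^ 2 * F.card * ∑ u ∈ F, η (u⁻¹ * g) ^ 2).Finite :=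
    hfin.subset fun g hg => right_ne_zero_of_mul hg
  have hfinD : (Function.support fun g => D g ^ 2).Finite :=
    hfin'.subset fun g hg h0 => hg (le_antisymm ((hle g).trans h0.le) (sq_nonneg _))
  calc ∑ᶠ g, D g ^ 2 ≤ ∑ᶠ g, B ^ 2 * F.card * ∑ u ∈ F, η (u⁻¹ * g) ^ 2 :=
        finsum_le_finsum' hfinD hfin' hle
    _ = B ^ 2 * F.card * ∑ u ∈ F, ∑ᶠ g, η (u⁻¹ * g) ^ 2 := by
        rw [← mul_finsum' _ _ hfin, finsum_sum_comm _ _ fun u _ => htr u]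
    _ = B ^ 2 * F.card * ∑ u ∈ F, ∑ᶠ g, η g ^ 2 := by
        congr 1
        exact Finset.sum_congr rfl fun u _ =>
          finsum_comp_equiv (Equiv.mulLeft u⁻¹) (f := fun g => η g ^ 2)
    _ = _ := by
        rw [Finset.sum_const, nsmul_eq_mul]
        ring

theorem exists_forall_pow_mul_norm_le [CompactSpace X] {ℓ : Γ → X → ℝ} (hℓ : IsLength ℓ)
    (k : ℕ) {f : Γ → X → ℂ} (hf : IsCc f) :
    ∃ B : ℝ, ∀ (u : Γ) (x : X), ℓ u x ^ k * ‖f u x‖ ≤ B := by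
  have h : ∀ u, ∀ᶠ B : ℝ in Filter.atTop, ∀ x, ℓ u x ^ k * ‖f u x‖ ≤ B := fun u => by
    obtain ⟨B, hB⟩ := (isCompact_range
      (((hℓ.1 u).pow k).mul (hf.1 u).norm)).bddAbove
    filter_upwards [Filter.eventually_ge_atTop B] with C hC x
    exact (hB ⟨x, rfl⟩).trans hC
  obtain ⟨B, hB, hB0⟩ := (((Filter.eventually_all_finite hf.2).2 fun u _ => h u).and
    (Filter.eventually_ge_atTop 0)).exists
  refine ⟨B, fun u x => ?_⟩
  by_cases hu : f u = 0
  · simpa [hu] using hB0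
  · exact hB u hu x

theorem IsLength.exists_pos_le [CompactSpace X] {ℓ : Γ → X → ℝ} (hℓ : IsLength ℓ)
    (hprop : IsProperLen ℓ) : ∃ c : ℝ, 0 < c ∧ ∀ g : Γ, g ≠ 1 → ∀ x : X, c ≤ ℓ g x := by
  have h : ∀ g ∈ {g : Γ | g ≠ 1 ∧ ∃ x : X, ℓ g x ≤ 1},
      ∀ᶠ c : ℝ in nhdsWithin 0 (Set.Ioi 0), ∀ x, c ≤ ℓ g x := by
    rintro g ⟨hg, x₀, -⟩
    have : Nonempty X := ⟨x₀⟩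
    obtain ⟨y, hy⟩ := (hℓ.1 g).exists_forall_le_of_hasCompactSupport
      (HasCompactSupport.of_compactSpace _)
    have hpos : 0 < ℓ g y :=
      lt_of_le_of_ne (hℓ.2.1 g y) fun h0 => hg ((hℓ.2.2.1 g y).1 h0.symm)
    filter_upwards [Ioc_mem_nhdsGT hpos] with c hc x
    exact hc.2.trans (hy x)
  obtain ⟨c, hc, hc0⟩ := (((Filter.eventually_all_finite (hprop 1)).2 h).and
    (Ioc_mem_nhdsGT (zero_lt_one (α := ℝ)))).exists
  refine ⟨c, hc0.1, fun g hg x => ?_⟩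
  by_cases hx : ∃ x : X, ℓ g x ≤ 1
  · exact hc g ⟨hg, hx⟩ x
  · push Not at hx
    exact hc0.2.trans (hx x).le

theorem IsCc.sqrt_finsum_le_hnorm {Γ X : Type*} [TopologicalSpace X]
    [CompactSpace X] {ξ : Γ → X → ℂ} (hξ : IsCc ξ) (x : X) :
    Real.sqrt (∑ᶠ g : Γ, ‖ξ g x‖ ^ 2) ≤ hnorm ξ := by
  have hcont : Continuous fun x => Real.sqrt (∑ᶠ g : Γ, ‖ξ g x‖ ^ 2) := by
    have : (fun x => Real.sqrt (∑ᶠ g : Γ, ‖ξ g x‖ ^ 2)) =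
        fun x => Real.sqrt (∑ g ∈ hξ.2.toFinset, ‖ξ g x‖ ^ 2) := by
      funext x
      rw [finsum_eq_sum_of_support_subset]
      intro g hg
      simp only [Set.Finite.coe_toFinset, Set.mem_ofPred_eq]
      intro h0
      exact hg (by simp [h0])
    rw [this]
    exact (continuous_finsetSum _ fun g _ => (hξ.1 g).norm.pow 2).sqrt
  exact le_ciSup (isCompact_range hcont).bddAbove x

/-- `Δ^k(f)` is bounded for the Hilbert-module norm, fibrewise. -/
theorem exists_forall_sqrt_deltaIter_le [CompactSpace X] {ℓ : Γ → X → ℝ} (hℓ : IsLength ℓ)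
    (k : ℕ) {f : Γ → X → ℂ} (hf : IsCc f) :
    ∃ M : ℝ, ∀ (ξ : Γ → X → ℂ), IsCc ξ → hnorm ξ ≤ 1 → ∀ x : X,
      Real.sqrt (∑ᶠ g : Γ, ‖deltaIter ℓ f k ξ g x‖ ^ 2) ≤ M := by
  obtain ⟨B, hB⟩ := exists_forall_pow_mul_norm_le hℓ k hf
  set F := hf.2.toFinset with hF
  refine ⟨|F.card * B|, fun ξ hξ h1 x => ?_⟩
  have hsupp := hξ.finite_support x
  have hbound : ∀ g, ‖deltaIter ℓ f k ξ g x‖ ≤ B * ∑ u ∈ F, ‖ξ (u⁻¹ * g) x‖ := fun g => by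
    rw [deltaIter_apply ℓ f k ξ x hsupp g,
      ← finsum_comp_equiv ((Equiv.inv Γ).trans (Equiv.mulRight g)),
      finsum_eq_sum_of_support_subset (s := F), Finset.mul_sum]
    · refine norm_sum_le_of_le _ fun u _ => ?_
      simp only [Equiv.trans_apply, Equiv.inv_apply, Equiv.coe_mulRight, mul_inv_rev, inv_inv,
        mul_inv_cancel_left, norm_mul, norm_pow, Complex.norm_real, Real.norm_eq_abs]
      refine mul_le_mul_of_nonneg_right (le_trans ?_ (hB u ((u⁻¹ * g) • x))) (norm_nonneg _)
      have := hℓ.abs_sub_le u (u⁻¹ * g) x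
      rw [mul_inv_cancel_left] at this
      gcongr
    · intro u hu
      simp only [hF, Set.Finite.coe_toFinset, Set.mem_ofPred_eq]
      intro h0
      exact hu (by simp [h0])
  have hsum := finsum_sq_le_of_le_sum_translates F B (fun h => ‖ξ h x‖)
    (fun g => ‖deltaIter ℓ f k ξ g x‖) (hsupp.subset fun h hh h0 => hh (by simp [h0]))
    (fun g => norm_nonneg _) hbound
  have hle1 : ∑ᶠ g : Γ, ‖ξ g x‖ ^ 2 ≤ 1 :=
    Real.sqrt_le_one.1 ((hξ.sqrt_finsum_le_hnorm x).trans h1)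
  calc Real.sqrt (∑ᶠ g : Γ, ‖deltaIter ℓ f k ξ g x‖ ^ 2) ≤ Real.sqrt ((F.card * B) ^ 2) :=
        Real.sqrt_le_sqrt (hsum.trans (mul_le_of_le_one_right (sq_nonneg _) hle1))
    _ = _ := Real.sqrt_sq_eq_abs _

theorem sqrt_finsum_deltaIter_le_lipK [CompactSpace X] {ℓ : Γ → X → ℝ} (hℓ : IsLength ℓ)
    (k : ℕ) {f : Γ → X → ℂ} (hf : IsCc f) {ξ : Γ → X → ℂ} (hξ : IsCc ξ) (h1 : hnorm ξ ≤ 1)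
    (x : X) : Real.sqrt (∑ᶠ g : Γ, ‖deltaIter ℓ f k ξ g x‖ ^ 2) ≤ lipK ℓ k f := by
  obtain ⟨M, hM⟩ := exists_forall_sqrt_deltaIter_le hℓ k hf
  have : Nonempty X := ⟨x⟩
  refine (le_ciSup (f := fun x => Real.sqrt (∑ᶠ g : Γ, ‖deltaIter ℓ f k ξ g x‖ ^ 2))
    ⟨M, ?_⟩ x).trans (le_csSup ⟨M, ?_⟩ ⟨ξ, hξ, h1, rfl⟩)
  · rintro _ ⟨y, rfl⟩
    exact hM ξ hξ h1 y
  · rintro _ ⟨η, hη, hη1, rfl⟩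
    exact ciSup_le fun y => hM η hη hη1 y

theorem lipK_nonneg (ℓ : Γ → X → ℝ) (k : ℕ) (f : Γ → X → ℂ) : 0 ≤ lipK ℓ k f := by
  refine Real.sSup_nonneg ?_
  rintro _ ⟨ξ, -, -, rfl⟩
  exact Real.iSup_nonneg fun x => Real.sqrt_nonneg _

theorem isCc_const {Γ X : Type*} [TopologicalSpace X]
    {c : Γ → ℂ} (hc : (Function.support c).Finite) :
    IsCc fun (g : Γ) (_ : X) => c g :=
  ⟨fun _ => continuous_const, hc.subset fun _ hg h0 => hg (funext fun _ => h0)⟩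

theorem hnorm_const_le {Γ X : Type*}
    {c : Γ → ℂ} {r : ℝ} (hr : 0 ≤ r) (hc : ∑ᶠ g, ‖c g‖ ^ 2 ≤ r ^ 2) :
    hnorm (fun (g : Γ) (_ : X) => c g) ≤ r :=
  Real.iSup_le (fun _ => Real.sqrt_le_iff.2 ⟨hr, hc⟩) hr

theorem sqrt_finsum_sq_mul_pow_le_lipK [CompactSpace X] {ℓ : Γ → X → ℝ} (hℓ : IsLength ℓ)
    (k : ℕ) {f : Γ → X → ℂ} (hf : IsCc f) (x : X) :
    Real.sqrt (∑ᶠ g : Γ, (‖f g x‖ * ℓ g x ^ k) ^ 2) ≤ lipK ℓ k f := by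
  classical
  have hsub : (Function.support (Pi.single (1 : Γ) (1 : ℂ))) ⊆ ({1} : Finset Γ) := by
    intro g hg
    by_contra h
    exact hg (Pi.single_eq_of_ne (by simpa using h) _)
  have hfin : (Function.support (Pi.single (1 : Γ) (1 : ℂ))).Finite :=
    (Finset.finite_toSet _).subset hsub
  have hcc : IsCc fun (g : Γ) (_ : X) => (Pi.single (1 : Γ) (1 : ℂ) : Γ → ℂ) g :=
    isCc_const hfin
  have hn : hnorm (fun (g : Γ) (_ : X) => (Pi.single (1 : Γ) (1 : ℂ) : Γ → ℂ) g) ≤ 1 := by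
    refine hnorm_const_le zero_le_one ?_
    rw [finsum_eq_single _ 1 fun g hg => by simp [Pi.single_eq_of_ne hg]]
    simp
  refine le_of_eq_of_le ?_ (sqrt_finsum_deltaIter_le_lipK hℓ k hf hcc hn x)
  congr 1
  refine finsum_congr fun g => ?_
  have h1 : ℓ 1 x = 0 := (hℓ.2.2.1 1 x).2 rfl
  rw [deltaIter_apply _ _ _ _ _ hfin, finsum_eq_single _ 1 fun h hh => by
    simp [Pi.single_eq_of_ne hh]]
  simp [h1, abs_of_nonneg (hℓ.2.1 g x), mul_comm]

theorem sqrt_finsum_inv_sq_mul_pow_le_lipK [CompactSpace X] {ℓ : Γ → X → ℝ} (hℓ : IsLength ℓ)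
    (k : ℕ) {f : Γ → X → ℂ} (hf : IsCc f) (x : X) :
    Real.sqrt (∑ᶠ g : Γ, (‖f g⁻¹ (g • x)‖ * ℓ g x ^ k) ^ 2) ≤ lipK ℓ k f := by
  set a : Γ → ℂ := fun g => ((0 - ℓ g x : ℝ) : ℂ) ^ k * f g⁻¹ (g • x) with ha
  have hna : ∀ g, ‖a g‖ = ‖f g⁻¹ (g • x)‖ * ℓ g x ^ k := fun g => by
    simp [ha, abs_of_nonneg (hℓ.2.1 g x), mul_comm]
  simp only [← hna]
  set N := Real.sqrt (∑ᶠ g, ‖a g‖ ^ 2) with hN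
  have hS : 0 ≤ ∑ᶠ g, ‖a g‖ ^ 2 := finsum_nonneg fun g => sq_nonneg _
  have hN2 : N ^ 2 = ∑ᶠ g, ‖a g‖ ^ 2 := Real.sq_sqrt hS
  rcases (Real.sqrt_nonneg _ : 0 ≤ N).eq_or_lt with h0 | hpos
  · rw [hN, ← h0]
    exact lipK_nonneg ℓ k f
  have hafin : (Function.support a).Finite := by
    refine (hf.2.preimage inv_injective.injOn).subset fun g hg h0 => hg ?_
    simp only [ha, h0, Pi.zero_apply, mul_zero]
  have hsq : (Function.support fun g => ‖a g‖ ^ 2).Finite :=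
    hafin.subset fun g hg h0 => hg (by simp [h0])
  set c : Γ → ℂ := fun g => (starRingEnd ℂ) (a g) / N with hc
  have hcfin : (Function.support c).Finite :=
    hafin.subset fun g hg h0 => hg (by simp [hc, h0])
  have hcn : hnorm (fun (g : Γ) (_ : X) => c g) ≤ 1 := by
    refine hnorm_const_le zero_le_one (le_of_eq ?_)
    have : ∀ g, ‖c g‖ ^ 2 = (N ^ 2)⁻¹ * ‖a g‖ ^ 2 := fun g => by
      simp only [hc, norm_div, RCLike.norm_conj, Complex.norm_real, Real.norm_eq_abs, div_pow,
        sq_abs]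
      ring
    rw [finsum_congr this, ← mul_finsum' _ _ hsq, ← hN2, one_pow]
    exact inv_mul_cancel₀ (pow_pos hpos 2).ne'
  have hccc : IsCc fun (g : Γ) (_ : X) => c g := isCc_const hcfin
  have hle := sqrt_finsum_deltaIter_le_lipK hℓ k hf hccc hcn x
  refine le_trans ?_ hle
  have hone : deltaIter ℓ f k (fun (g : Γ) (_ : X) => c g) 1 x = N := by
    have h1 : ℓ 1 x = 0 := (hℓ.2.2.1 1 x).2 rfl
    rw [deltaIter_apply _ _ _ (fun g _ => c g) x hcfin]
    have : ∀ h, ((ℓ 1 x - ℓ h x : ℝ) : ℂ) ^ k * f (1 * h⁻¹) (h • x) * c h =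
        (((N⁻¹ * ‖a h‖ ^ 2 : ℝ)) : ℂ) := fun h => by
      rw [h1, one_mul]
      change a h * ((starRingEnd ℂ) (a h) / N) = _
      rw [← mul_div_assoc, Complex.mul_conj, Complex.normSq_eq_norm_sq]
      push_cast
      ring
    have hfs : (Function.support fun h => N⁻¹ * ‖a h‖ ^ 2).Finite :=
      hsq.subset fun h hh => right_ne_zero_of_mul hh
    refine (finsum_congr this).trans
      (((Complex.ofRealHom : ℝ →+* ℂ).toAddMonoidHom.map_finsum hfs).symm.trans ?_)
    rw [← mul_finsum' _ _ hsq, ← hN2]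
    change ((N⁻¹ * N ^ 2 : ℝ) : ℂ) = N
    congr 1
    field_simp
  have hfinΔ : (Function.support fun g =>
      ‖deltaIter ℓ f k (fun (g : Γ) (_ : X) => c g) g x‖ ^ 2).Finite := by
    refine (hf.2.mul hcfin).subset fun g hg => ?_
    by_contra hmem
    refine hg ?_
    have : deltaIter ℓ f k (fun (g : Γ) (_ : X) => c g) g x = 0 := by
      rw [deltaIter_apply _ _ _ (fun g _ => c g) x hcfin]
      refine finsum_eq_zero_of_forall_eq_zero fun h => ?_
      by_contra hne
      refine hmem ⟨g * h⁻¹, fun h0 => hne (by simp [h0]), h, right_ne_zero_of_mul hne, ?_⟩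
      simp
    simp [this]
  refine Real.le_sqrt_of_sq_le ?_
  have := single_le_finsum 1 hfinΔ fun g => sq_nonneg _
  simpa [hone] using this

theorem sqrt_finsum_weight_le {ι : Type*} {a l : ι → ℝ} {C p : ℝ} {k : ℕ}
    (hpk : p ≤ k) (hC : 0 ≤ C) (ha : (Function.support a).Finite) (hl : ∀ i, 0 ≤ l i)
    (h : ∀ i, a i ≠ 0 → 1 + l i ≤ C * l i) :
    Real.sqrt (∑ᶠ i, a i ^ 2 * (1 + l i) ^ (2 * p)) ≤
      C ^ k * Real.sqrt (∑ᶠ i, (a i * l i ^ k) ^ 2) := by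
  have hfin : (Function.support fun i => (a i * l i ^ k) ^ 2).Finite :=
    ha.subset fun i hi h0 => hi (by simp [h0])
  rw [← Real.sqrt_sq (pow_nonneg hC k), ← Real.sqrt_mul (sq_nonneg _), mul_finsum' _ _ hfin]
  refine Real.sqrt_le_sqrt (finsum_le_finsum' ?_ ?_ fun i => ?_)
  · exact ha.subset fun i hi h0 => hi (by simp [h0])
  · exact hfin.subset fun i hi => right_ne_zero_of_mul hi
  · by_cases h0 : a i = 0
    · simp [h0]
    have h1 : (1 + l i) ^ (2 * p) ≤ (C * l i) ^ (2 * k) := by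
      calc (1 + l i) ^ (2 * p) ≤ (1 + l i) ^ ((2 * k : ℕ) : ℝ) :=
            Real.rpow_le_rpow_of_exponent_le (by linarith [hl i]) (by push_cast; linarith)
        _ = (1 + l i) ^ (2 * k) := Real.rpow_natCast _ _
        _ ≤ _ := pow_le_pow_left₀ (by linarith [hl i]) (h i h0) _
    calc a i ^ 2 * (1 + l i) ^ (2 * p) ≤ a i ^ 2 * (C * l i) ^ (2 * k) := by gcongr
      _ = _ := by ring

/-- `‖f‖_{2,p,ℓ} ≤ α L_ℓ^k(f)` for all `f ∈ C_c(Γ⋉X)` vanishing on the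
unit space, whenever `ℓ` is a continuous proper length function and `k > p > 0`. -/
theorem stmt_11 [CompactSpace X] [T2Space X] [ContinuousConstSMul Γ X]
    (ℓ : Γ → X → ℝ) (hℓ : IsLength ℓ) (hprop : IsProperLen ℓ)
    (p : ℝ) (hp : 0 < p) (k : ℕ) (hk : p < (k : ℝ)) :
    ∃ α : ℝ, 0 < α ∧ ∀ f : Γ → X → ℂ, IsCc f → (∀ x : X, f 1 x = 0) →
      norm2 ℓ p f ≤ α * lipK ℓ k f := by
  obtain ⟨c, hc, hcl⟩ := hℓ.exists_pos_le hprop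
  have hC : 0 < 1 + c⁻¹ := by positivity
  refine ⟨(1 + c⁻¹) ^ k, pow_pos hC k, fun f hf hf1 => ?_⟩
  have hw : ∀ g : Γ, g ≠ 1 → ∀ x : X, 1 + ℓ g x ≤ (1 + c⁻¹) * ℓ g x := fun g hg x => by
    have : 1 ≤ c⁻¹ * ℓ g x := by
      rw [← inv_mul_cancel₀ hc.ne']
      exact mul_le_mul_of_nonneg_left (hcl g hg x) (inv_nonneg.2 hc.le)
    linarith
  have h0 : 0 ≤ (1 + c⁻¹) ^ k * lipK ℓ k f :=
    mul_nonneg (pow_pos hC k).le (lipK_nonneg ℓ k f)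
  refine max_le (Real.iSup_le (fun x => ?_) h0) (Real.iSup_le (fun x => ?_) h0)
  · refine (sqrt_finsum_weight_le hk.le hC.le ?_ (fun g => hℓ.2.1 g x) fun g hg => ?_).trans
      (mul_le_mul_of_nonneg_left (sqrt_finsum_sq_mul_pow_le_lipK hℓ k hf x) (pow_pos hC k).le)
    · exact hf.2.subset fun g hg h => hg (by simp [h])
    · refine hw g (fun h => hg ?_) x
      simp [h, hf1]
  · refine (sqrt_finsum_weight_le hk.le hC.le ?_ (fun g => hℓ.2.1 g x) fun g hg => ?_).trans
      (mul_le_mul_of_nonneg_left (sqrt_finsum_inv_sq_mul_pow_le_lipK hℓ k hf x)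
        (pow_pos hC k).le)
    · exact (hf.2.preimage inv_injective.injOn).subset fun g hg h => hg (by simp [h])
    · refine hw g (fun h => hg ?_) x
      simp [h, hf1]
end
end
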